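/- Let B > 2, k > 0, and suppose (α_L*, α_R*) ∈ (1/2, 1)^2 satisfies exp(B sqrt(k)(1 - 2α_R*)) = (1 - α_L*)/α_L* and exp((B/sqrt(k))(1 - 2α_L*)) = (1 - α_R*)/α_R*. Then (1 - α_L*)(1 - α_R*) B^2 < 1. -/

import Mathlib

/-- If `exp (-u)` equals the odds `(1 - a) / a`, then `u` is controlled by `log x < x - 1`. -/
lemma one_sub_mul_lt_of_exp_neg_eq_odds {a u : ℝ} (ha : a ∈ Set.Ioo (0 : ℝ) 1) (hu : u ≠ 0)
    (h : Real.exp (-u) = (1 - a) / a) : (1 - a) * u < 2 * a - 1 := by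
  obtain ⟨h0, h1⟩ := ha
  have hexp : Real.exp u = a / (1 - a) := by
    rw [← inv_inj, ← Real.exp_neg, h, inv_div]
  have hlt := Real.add_one_lt_exp hu
  rw [hexp, lt_div_iff₀ (by linarith)] at hlt
  linarith

theorem stmt7 (B k αL αR : ℝ) (hB : 2 < B) (hk : 0 < k)
    (hαL : αL ∈ Set.Ioo (1 / 2 : ℝ) 1) (hαR : αR ∈ Set.Ioo (1 / 2 : ℝ) 1)
    (h1 : Real.exp (B * Real.sqrt k * (1 - 2 * αR)) = (1 - αL) / αL)
    (h2 : Real.exp ((B / Real.sqrt k) * (1 - 2 * αL)) = (1 - αR) / αR) :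
    (1 - αL) * (1 - αR) * B ^ 2 < 1 := by
  obtain ⟨hL, hL'⟩ := hαL
  obtain ⟨hR, hR'⟩ := hαR
  have hs : 0 < Real.sqrt k := Real.sqrt_pos.mpr hk
  have hB0 : 0 < B := by linarith
  have hzL : 0 < 2 * αL - 1 := by linarith
  have hzR : 0 < 2 * αR - 1 := by linarith
  have hwL : 0 < 1 - αL := by linarith
  have hwR : 0 < 1 - αR := by linarith
  have hboundL : (1 - αL) * (B * Real.sqrt k * (2 * αR - 1)) < 2 * αL - 1 :=
    one_sub_mul_lt_of_exp_neg_eq_odds ⟨by linarith, hL'⟩ (by positivity)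
      (by rw [← h1]; congr 1; ring)
  have hboundR : (1 - αR) * (B / Real.sqrt k * (2 * αL - 1)) < 2 * αR - 1 :=
    one_sub_mul_lt_of_exp_neg_eq_odds ⟨by linarith, hR'⟩ (by positivity)
      (by rw [← h2]; congr 1; ring)
  have hprod := mul_lt_mul'' hboundL hboundR (by positivity) (by positivity)
  have hfactor : (1 - αL) * (B * Real.sqrt k * (2 * αR - 1)) *
      ((1 - αR) * (B / Real.sqrt k * (2 * αL - 1))) =
      (1 - αL) * (1 - αR) * B ^ 2 * ((2 * αL - 1) * (2 * αR - 1)) := by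
    field_simp
  rw [hfactor] at hprod
  exact (mul_lt_iff_lt_one_left (mul_pos hzL hzR)).mp hprod
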